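/- The ring homomorphisms ℤ → ℤ[1/2][x]/(x² + 1) and ℤ → ℤ[1/3][x]/(x² + x + 1) are étale (flat, unramified/formally étale, and of finite presentation), and they are jointly surjective on prime spectra: every prime ideal of ℤ is the preimage of a prime ideal of ℤ[1/2][x]/(x² + 1) or of a prime ideal of ℤ[1/3][x]/(x² + x + 1). Hence Spec(ℤ[1/2][x]/(x² + 1)) ⊔ Spec(ℤ[1/3][x]/(x² + x + 1)) → Spec ℤ is an étale cover. -/

import Mathlib

open Polynomial

/-- `ℤ[1/2][x]/(x² + 1)`. -/
noncomputable abbrev GaussRing : Type :=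
  AdjoinRoot (Polynomial.X ^ 2 + 1 : Polynomial (Localization.Away (2 : ℤ)))

/-- `ℤ[1/3][x]/(x² + x + 1)`. -/
noncomputable abbrev EisensteinRing : Type :=
  AdjoinRoot (Polynomial.X ^ 2 + Polynomial.X + 1 : Polynomial (Localization.Away (3 : ℤ)))

/-- Adjoining a root of a monic separable polynomial gives an étale algebra. -/
theorem Algebra.Etale.adjoinRoot_of_separable {R : Type*} [CommRing R] {f : R[X]}
    (hf : f.Monic) (hsep : f.Separable) : Algebra.Etale R (AdjoinRoot f) := by
  obtain ⟨a, b, hab⟩ := hsep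
  let P : StandardEtalePair R := ⟨f, hf, 1, b, a, 0, by rw [pow_zero, ← hab]; ring⟩
  have hu : IsUnit (AdjoinRoot.mk P.f P.g) := by simp [P]
  exact .of_equiv (P.equivAwayAdjoinRoot.trans
    ((IsLocalization.atUnit (AdjoinRoot f) (Localization.Away (AdjoinRoot.mk P.f P.g))
      (AdjoinRoot.mk P.f P.g) hu).symm.restrictScalars R))

/-- Adjoining a root of a nonconstant monic polynomial induces a surjection on spectra. -/
theorem PrimeSpectrum.comap_adjoinRoot_surjective {R : Type*} [CommRing R] [IsDomain R]
    {f : R[X]} (hf : f.Monic) (hdeg : f.degree ≠ 0) :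
    Function.Surjective (PrimeSpectrum.comap (algebraMap R (AdjoinRoot f))) := by
  have := hf.finite_adjoinRoot
  have := hf.free_adjoinRoot
  exact PrimeSpectrum.comap_surjective_iff_injective_of_finite.mpr
    (AdjoinRoot.of.injective_of_degree_ne_zero hdeg)

/-- A prime not containing `r` is hit by the spectrum of a monic extension of `R[1/r]`. -/
theorem PrimeSpectrum.exists_comap_adjoinRoot_away_eq {R : Type*} [CommRing R] [IsDomain R]
    {r : R} (hr : r ≠ 0) {f : (Localization.Away r)[X]} (hf : f.Monic) (hdeg : f.degree ≠ 0)
    {p : PrimeSpectrum R} (hp : r ∉ p.asIdeal) :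
    ∃ q : PrimeSpectrum (AdjoinRoot f),
      PrimeSpectrum.comap (algebraMap R (AdjoinRoot f)) q = p := by
  have : IsDomain (Localization.Away r) :=
    IsLocalization.isDomain_localization (powers_le_nonZeroDivisors_of_noZeroDivisors hr)
  obtain ⟨p', rfl⟩ : p ∈ Set.range (PrimeSpectrum.comap (algebraMap R (Localization.Away r))) := by
    rwa [PrimeSpectrum.localization_away_comap_range _ r]
  obtain ⟨q, rfl⟩ := PrimeSpectrum.comap_adjoinRoot_surjective hf hdeg p'
  refine ⟨q, ?_⟩
  rw [← PrimeSpectrum.comap_comp_apply, ← IsScalarTower.algebraMap_eq]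

theorem Polynomial.separable_X_sq_add_one {R : Type*} [CommRing R] (h : IsUnit (2 : R)) :
    (X ^ 2 + 1 : R[X]).Separable := by
  obtain ⟨c, hc⟩ := h.exists_right_inv
  refine ⟨1, -C c * X, ?_⟩
  have hc' : (2 : R[X]) * C c = 1 := by simpa [C_ofNat] using congrArg C hc
  simp only [derivative_add, derivative_X_pow, derivative_one, Nat.cast_ofNat, C_ofNat]
  linear_combination -X ^ 2 * hc'

theorem Polynomial.separable_X_sq_add_X_add_one {R : Type*} [CommRing R] (h : IsUnit (3 : R)) :
    (X ^ 2 + X + 1 : R[X]).Separable := by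
  obtain ⟨c, hc⟩ := h.exists_right_inv
  refine ⟨4 * C c, -C c * (2 * X + 1), ?_⟩
  have hc' : (3 : R[X]) * C c = 1 := by simpa [C_ofNat] using congrArg C hc
  simp only [derivative_add, derivative_X_pow, derivative_X, derivative_one, Nat.cast_ofNat,
    C_ofNat]
  linear_combination hc'

theorem Algebra.Etale.adjoinRoot_away {R : Type*} [CommRing R] (r : R)
    {f : (Localization.Away r)[X]} (hf : f.Monic) (hsep : f.Separable) :
    Algebra.Etale R (AdjoinRoot f) := by
  have := Algebra.Etale.adjoinRoot_of_separable hf hsep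
  have : Algebra.Etale R (Localization.Away r) := .of_isLocalizationAway r
  exact .comp R (Localization.Away r) _

/-- The ring maps `ℤ → ℤ[1/2][x]/(x² + 1)` and `ℤ → ℤ[1/3][x]/(x² + x + 1)` are étale
(formally étale and of finite presentation) and jointly surjective on prime spectra:
every prime of `ℤ` is the preimage of a prime of one of the two rings. Hence
`Spec(ℤ[1/2][x]/(x² + 1)) ⊔ Spec(ℤ[1/3][x]/(x² + x + 1)) → Spec ℤ` is an étale cover. -/
theorem etale_cover_of_spec_int :
    Algebra.Etale ℤ GaussRing ∧ Algebra.Etale ℤ EisensteinRing ∧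
      ∀ p : PrimeSpectrum ℤ,
        (∃ q : PrimeSpectrum GaussRing,
          PrimeSpectrum.comap (algebraMap ℤ GaussRing) q = p) ∨
        (∃ q : PrimeSpectrum EisensteinRing,
          PrimeSpectrum.comap (algebraMap ℤ EisensteinRing) q = p) := by
  have h2 : IsUnit (2 : Localization.Away (2 : ℤ)) := by
    simpa using IsLocalization.Away.algebraMap_isUnit (S := Localization.Away (2 : ℤ)) (2 : ℤ)
  have h3 : IsUnit (3 : Localization.Away (3 : ℤ)) := by
    simpa using IsLocalization.Away.algebraMap_isUnit (S := Localization.Away (3 : ℤ)) (3 : ℤ)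
  have : Nontrivial (Localization.Away (2 : ℤ)) :=
    (IsLocalization.injective _
      (powers_le_nonZeroDivisors_of_noZeroDivisors (two_ne_zero' ℤ))).nontrivial
  have : Nontrivial (Localization.Away (3 : ℤ)) :=
    (IsLocalization.injective _
      (powers_le_nonZeroDivisors_of_noZeroDivisors (three_ne_zero' ℤ))).nontrivial
  have hf : (X ^ 2 + 1 : (Localization.Away (2 : ℤ))[X]).Monic := by monicity!
  have hg : (X ^ 2 + X + 1 : (Localization.Away (3 : ℤ))[X]).Monic := by monicity!
  have hf' : (X ^ 2 + 1 : (Localization.Away (2 : ℤ))[X]).degree = 2 := by compute_degree!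
  have hg' : (X ^ 2 + X + 1 : (Localization.Away (3 : ℤ))[X]).degree = 2 := by compute_degree!
  refine ⟨.adjoinRoot_away 2 hf (separable_X_sq_add_one h2),
    .adjoinRoot_away 3 hg (separable_X_sq_add_X_add_one h3), fun p ↦ ?_⟩
  by_cases hp : (2 : ℤ) ∈ p.asIdeal
  · refine .inr (PrimeSpectrum.exists_comap_adjoinRoot_away_eq three_ne_zero hg
      (by simp [hg']) fun hp' ↦ p.2.ne_top ?_)
    rw [Ideal.eq_top_iff_one]
    simpa using sub_mem hp' hp
  · exact .inl (PrimeSpectrum.exists_comap_adjoinRoot_away_eq two_ne_zero hf (by simp [hf']) hp)
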